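/- arXiv:2103.05369 — 2 statements merged into one kernel-verified Lean document; each statement's English description precedes it below -/
import Mathlib

section
/- Second-order interpolation error for the odd-even extension: Let f : (0, π/2) → ℝ be twice differentiable, with f' extending continuously to [0, π/2], f'(0⁺) = 0, and with the one-sided limits f''(0⁺) and f''((π/2)⁻) existing and f'' bounded on (0, π/2). Let f^e be the 2π-periodic odd-even extension of f, defined by f^e(x) = f(x) for x ∈ (0, π/2], f^e(x) = 2f((π/2)⁻) − f(π − x) for x ∈ (π/2, π], f^e(x) = f^e(2π − x) for x ∈ (π, 2π), and extended 2π-periodically to ℝ. Then there exists a constant K₁ such that for every integer N ≥ 1, ‖f^e − I_N(f^e)‖ ≤ K₁ N^{−2}. -/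
open Real MeasureTheory

noncomputable section

/-- Equispaced nodes `x_j = jπ/N`. -/
def node (N : ℕ) (j : ℕ) : ℝ := j * Real.pi / N

/-- The trigonometric polynomial `x ↦ Σ_{k=-N}^{N-1} c_k e^{ikx}`. -/
def trigPoly (N : ℕ) (c : ℤ → ℂ) : ℝ → ℂ := fun x =>
  ∑ k ∈ Finset.Icc (-(N : ℤ)) ((N : ℤ) - 1), c k * Complex.exp (Complex.I * k * x)

/-- Membership in the space `S_N` of trigonometric polynomials of degree `N`. -/
def memSN (N : ℕ) (v : ℝ → ℂ) : Prop := ∃ c : ℤ → ℂ, v = trigPoly N c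

/-- Discrete Fourier transform coefficients of `u` at the `2N` equispaced nodes. -/
def dftCoeff (N : ℕ) (u : ℝ → ℂ) (k : ℤ) : ℂ :=
  (1 / (2 * N : ℂ)) *
    ∑ j ∈ Finset.range (2 * N), u (node N j) * Complex.exp (-(Complex.I * k * node N j))

/-- The trigonometric interpolant `I_N(u) ∈ S_N` of `u` at the equispaced nodes. -/
def interp (N : ℕ) (u : ℝ → ℂ) : ℝ → ℂ := trigPoly N (dftCoeff N u)

/-- The `L²(0, 2π)` norm. -/
def l2norm {E : Type*} [NormedAddCommGroup E] (v : ℝ → E) : ℝ :=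
  Real.sqrt (∫ x in (0:ℝ)..(2 * Real.pi), ‖v x‖ ^ 2)

/-- The sup norm over `[0, 2π]`. -/
def supNorm {E : Type*} [NormedAddCommGroup E] (v : ℝ → E) : ℝ :=
  ⨆ x : Set.Icc (0:ℝ) (2 * Real.pi), ‖v x.1‖

/-- `u` has the (pointwise convergent) Fourier expansion with coefficients `c`. -/
def hasFourierCoeffs (u : ℝ → ℂ) (c : ℤ → ℂ) : Prop :=
  ∀ x : ℝ, HasSum (fun k : ℤ => c k * Complex.exp (Complex.I * k * x)) (u x)

/-- Membership in the periodic Sobolev space `H^m_p`, expressed via Fourier coefficients. -/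
def inHp (m : ℕ) (c : ℤ → ℂ) : Prop :=
  Summable fun k : ℤ => (|k| : ℝ) ^ (2 * m) * ‖c k‖ ^ 2

/-- `‖∂^m u/∂x^m‖ = (2π Σ_k |k|^{2m}|c_k|²)^{1/2}` for `u` with Fourier coefficients `c`. -/
def sobNorm (m : ℕ) (c : ℤ → ℂ) : ℝ :=
  Real.sqrt (2 * Real.pi * ∑' k : ℤ, (|k| : ℝ) ^ (2 * m) * ‖c k‖ ^ 2)

/-- Core of the odd-even extension on `[0, π]`: equals `f` on `[0, π/2]` and equals
`2f((π/2)⁻) − f(π − y)` on `(π/2, π]`. -/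
def oeCore (f : ℝ → ℝ) (y : ℝ) : ℝ :=
  if y ≤ Real.pi / 2 then f y else 2 * f (Real.pi / 2) - f (Real.pi - y)

/-- The `2π`-periodic odd-even extension `f^e` of `f : (0, π/2) → ℝ`:
`f^e = f` on `(0, π/2]`, `f^e(x) = 2f((π/2)⁻) − f(π − x)` on `(π/2, π]`,
`f^e(x) = f^e(2π − x)` on `(π, 2π)`, extended `2π`-periodically. -/
def oddEvenExt (f : ℝ → ℝ) (x : ℝ) : ℝ :=
  let y := x - 2 * Real.pi * (⌊x / (2 * Real.pi)⌋ : ℤ)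
  if y ≤ Real.pi then oeCore f y else oeCore f (2 * Real.pi - y)

/-! ### Discrete and continuous orthogonality -/

theorem sum_exp_node {N : ℕ} (hN : 1 ≤ N) {m : ℤ} (hm : |m| < 2 * N) :
    ∑ j ∈ Finset.range (2 * N), Complex.exp (Complex.I * m * node N j)
      = if m = 0 then (2 * N : ℂ) else 0 := by
  have hN' : (N : ℂ) ≠ 0 := by exact_mod_cast (by omega : N ≠ 0)
  split_ifs with h
  · simp [h]
  · set ζ : ℂ := Complex.exp (Complex.I * m * (Real.pi / N)) with hζ
    have hpow : ∀ j : ℕ, Complex.exp (Complex.I * m * node N j) = ζ ^ j := by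
      intro j
      rw [hζ, ← Complex.exp_nat_mul, node]
      push_cast
      congr 1
      ring
    simp_rw [hpow]
    have hone : ζ ^ (2 * N) = 1 := by
      rw [hζ, ← Complex.exp_nat_mul, Complex.exp_eq_one_iff]
      refine ⟨m, ?_⟩
      push_cast
      field_simp
    have hne : ζ ≠ 1 := by
      rw [hζ, Ne, Complex.exp_eq_one_iff]
      rintro ⟨n, hn⟩
      have hπ : (Real.pi : ℂ) ≠ 0 := by exact_mod_cast Real.pi_ne_zero
      have h1 : (m : ℂ) = ((2 * N * n : ℤ) : ℂ) := by
        push_cast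
        have hI := Complex.I_ne_zero
        field_simp at hn
        linear_combination hn
      have h2 : m = 2 * N * n := by exact_mod_cast h1
      have h3 : n ≠ 0 := by
        rintro rfl
        simp at h2
        exact h h2
      have h4 : 1 ≤ |n| := Int.one_le_abs h3
      rw [h2, abs_mul, abs_of_nonneg (by positivity : (0 : ℤ) ≤ 2 * N)] at hm
      nlinarith
    have := mul_geom_sum ζ (2 * N)
    rw [hone, sub_self] at this
    exact (mul_eq_zero.mp this).resolve_left (sub_ne_zero.mpr hne)

theorem dftCoeff_trigPoly {N : ℕ} (hN : 1 ≤ N) (c : ℤ → ℂ) {k : ℤ}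
    (hk : k ∈ Finset.Icc (-(N : ℤ)) ((N : ℤ) - 1)) : dftCoeff N (trigPoly N c) k = c k := by
  have hN' : (2 * N : ℂ) ≠ 0 := by exact_mod_cast (by omega : 2 * N ≠ 0)
  unfold dftCoeff trigPoly
  simp_rw [Finset.sum_mul]
  rw [Finset.sum_comm]
  have : ∀ l ∈ Finset.Icc (-(N : ℤ)) ((N : ℤ) - 1),
      ∑ j ∈ Finset.range (2 * N), c l * Complex.exp (Complex.I * l * node N j) *
        Complex.exp (-(Complex.I * k * node N j)) = if l = k then (2 * N : ℂ) * c l else 0 := by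
    intro l hl
    have h := sum_exp_node hN (m := l - k) (by
      rw [Finset.mem_Icc] at hk hl
      rw [abs_lt]
      omega)
    simp only [sub_eq_zero] at h
    calc _ = c l * ∑ j ∈ Finset.range (2 * N),
          Complex.exp (Complex.I * (l - k : ℤ) * node N j) := by
          rw [Finset.mul_sum]
          refine Finset.sum_congr rfl fun j _ => ?_
          rw [mul_assoc, ← Complex.exp_add]
          push_cast
          congr 2
          ring
      _ = _ := by
          rw [h]
          split_ifs
          · ring
          · simp
  rw [Finset.sum_congr rfl this, Finset.sum_ite_eq', if_pos hk, ← mul_assoc,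
    one_div_mul_cancel hN', one_mul]

theorem interp_trigPoly {N : ℕ} (hN : 1 ≤ N) (c : ℤ → ℂ) :
    interp N (trigPoly N c) = trigPoly N c := by
  funext x
  unfold interp
  rw [trigPoly, trigPoly]
  exact Finset.sum_congr rfl fun k hk => by rw [dftCoeff_trigPoly hN c hk]

theorem interp_sub (N : ℕ) (u v : ℝ → ℂ) (x : ℝ) :
    interp N (fun y => u y - v y) x = interp N u x - interp N v x := by
  simp only [interp, trigPoly, dftCoeff, sub_mul, Finset.sum_sub_distrib, mul_sub]

theorem star_trigPoly (N : ℕ) (c : ℤ → ℂ) (x : ℝ) :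
    (starRingEnd ℂ) (trigPoly N c x) = ∑ k ∈ Finset.Icc (-(N : ℤ)) ((N : ℤ) - 1),
      (starRingEnd ℂ) (c k) * Complex.exp (-(Complex.I * k * x)) := by
  simp [trigPoly, map_sum, ← Complex.exp_conj]

theorem sum_mul_star_trigPoly {N : ℕ} (hN : 1 ≤ N) (v : ℝ → ℂ) (c : ℤ → ℂ) :
    ∑ j ∈ Finset.range (2 * N), v (node N j) * (starRingEnd ℂ) (trigPoly N c (node N j))
      = 2 * N * ∑ k ∈ Finset.Icc (-(N : ℤ)) ((N : ℤ) - 1),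
          dftCoeff N v k * (starRingEnd ℂ) (c k) := by
  have hN' : (2 * N : ℂ) ≠ 0 := by exact_mod_cast (by omega : 2 * N ≠ 0)
  simp_rw [star_trigPoly, Finset.mul_sum]
  rw [Finset.sum_comm]
  refine Finset.sum_congr rfl fun k _ => ?_
  rw [dftCoeff, ← mul_assoc, ← mul_assoc, mul_one_div_cancel hN', one_mul, Finset.sum_mul]
  exact Finset.sum_congr rfl fun j _ => by ring

/-- Bessel's inequality for the discrete Fourier transform. -/
theorem sum_sq_dftCoeff_le {N : ℕ} (hN : 1 ≤ N) (v : ℝ → ℂ) :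
    2 * N * ∑ k ∈ Finset.Icc (-(N : ℤ)) ((N : ℤ) - 1), ‖dftCoeff N v k‖ ^ 2
      ≤ ∑ j ∈ Finset.range (2 * N), ‖v (node N j)‖ ^ 2 := by
  set s := interp N v with hs
  set T := ∑ k ∈ Finset.Icc (-(N : ℤ)) ((N : ℤ) - 1), ‖dftCoeff N v k‖ ^ 2 with hT
  have hcross : ∀ w : ℝ → ℂ, (∀ k ∈ Finset.Icc (-(N : ℤ)) ((N : ℤ) - 1),
      dftCoeff N w k = dftCoeff N v k) →
      ∑ j ∈ Finset.range (2 * N), (w (node N j) * (starRingEnd ℂ) (s (node N j))).re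
        = 2 * N * T := by
    intro w hw
    rw [← Complex.re_sum, hs]
    unfold interp
    rw [sum_mul_star_trigPoly hN]
    have : ∑ k ∈ Finset.Icc (-(N : ℤ)) ((N : ℤ) - 1),
        dftCoeff N w k * (starRingEnd ℂ) (dftCoeff N v k) = (T : ℂ) := by
      rw [hT]
      push_cast
      refine Finset.sum_congr rfl fun k hk => ?_
      rw [hw k hk, Complex.mul_conj']
    rw [this]
    norm_cast
  have h1 := hcross v fun _ _ => rfl
  have h2 := hcross s fun k hk => dftCoeff_trigPoly hN _ hk
  have h3 : 0 ≤ ∑ j ∈ Finset.range (2 * N), ‖v (node N j) - s (node N j)‖ ^ 2 := by positivity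
  have h4 : ∀ j ∈ Finset.range (2 * N), ‖v (node N j) - s (node N j)‖ ^ 2
      = ‖v (node N j)‖ ^ 2 - 2 * (v (node N j) * (starRingEnd ℂ) (s (node N j))).re
        + (s (node N j) * (starRingEnd ℂ) (s (node N j))).re := by
    intro j _
    rw [Complex.sq_norm, Complex.normSq_sub, Complex.sq_norm, Complex.mul_conj (s _),
      Complex.ofReal_re]
    ring
  rw [Finset.sum_congr rfl h4, Finset.sum_add_distrib, Finset.sum_sub_distrib, ← Finset.mul_sum,
    h1, h2] at h3
  linarith

theorem integral_exp_int_mul (m : ℤ) :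
    ∫ x in (0 : ℝ)..(2 * Real.pi), Complex.exp (Complex.I * m * x)
      = if m = 0 then (2 * Real.pi : ℂ) else 0 := by
  split_ifs with h
  · simp [h]
  · have hm : (Complex.I * m : ℂ) ≠ 0 := mul_ne_zero Complex.I_ne_zero (by exact_mod_cast h)
    rw [integral_exp_mul_complex hm]
    have : Complex.exp (Complex.I * m * (2 * Real.pi : ℝ)) = 1 := by
      rw [Complex.exp_eq_one_iff]
      exact ⟨m, by push_cast; ring⟩
    rw [this]
    simp

theorem continuous_trigPoly (N : ℕ) (c : ℤ → ℂ) : Continuous (trigPoly N c) := by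
  unfold trigPoly
  fun_prop

theorem integral_norm_sq_trigPoly (N : ℕ) (c : ℤ → ℂ) :
    ∫ x in (0 : ℝ)..(2 * Real.pi), ‖trigPoly N c x‖ ^ 2
      = 2 * Real.pi * ∑ k ∈ Finset.Icc (-(N : ℤ)) ((N : ℤ) - 1), ‖c k‖ ^ 2 := by
  apply Complex.ofReal_injective
  rw [← intervalIntegral.integral_ofReal]
  have h1 : ∀ x : ℝ, ((‖trigPoly N c x‖ ^ 2 : ℝ) : ℂ) =
      ∑ k ∈ Finset.Icc (-(N : ℤ)) ((N : ℤ) - 1), ∑ l ∈ Finset.Icc (-(N : ℤ)) ((N : ℤ) - 1),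
        c k * (starRingEnd ℂ) (c l) * Complex.exp (Complex.I * (k - l : ℤ) * x) := by
    intro x
    rw [Complex.ofReal_pow, ← Complex.mul_conj', star_trigPoly]
    unfold trigPoly
    rw [Finset.sum_mul_sum]
    refine Finset.sum_congr rfl fun k _ => Finset.sum_congr rfl fun l _ => ?_
    rw [mul_mul_mul_comm, ← Complex.exp_add]
    push_cast
    congr 2
    ring
  simp_rw [h1]
  rw [intervalIntegral.integral_finsetSum
    fun k _ => Continuous.intervalIntegrable (by fun_prop) _ _]
  push_cast
  rw [Finset.mul_sum]
  refine Finset.sum_congr rfl fun k hk => ?_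
  rw [intervalIntegral.integral_finsetSum
    fun k _ => Continuous.intervalIntegrable (by fun_prop) _ _]
  have h2 : ∀ l : ℤ, ∫ x in (0 : ℝ)..(2 * Real.pi),
      c k * (starRingEnd ℂ) (c l) * Complex.exp (Complex.I * ((k : ℂ) - l) * x)
      = if k = l then 2 * Real.pi * (c k * (starRingEnd ℂ) (c l)) else 0 := by
    intro l
    rw [intervalIntegral.integral_const_mul]
    have := integral_exp_int_mul (k - l)
    push_cast at this
    rw [this]
    simp only [sub_eq_zero]
    split_ifs
    · ring
    · simp
  simp_rw [h2]
  rw [Finset.sum_ite_eq, if_pos hk, Complex.mul_conj']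

/-- The interpolation error is controlled by the uniform error of any competitor in `S_N`. -/
theorem l2norm_sub_interp_le {N : ℕ} (hN : 1 ≤ N) {u : ℝ → ℂ} (hu : Continuous u) (c : ℤ → ℂ)
    {ε : ℝ} (hε : 0 ≤ ε) (h : ∀ x, ‖u x - trigPoly N c x‖ ≤ ε) :
    l2norm (fun x => u x - interp N u x) ≤ Real.sqrt (8 * Real.pi) * ε := by
  set v : ℝ → ℂ := fun x => u x - trigPoly N c x with hv
  have hN' : (0 : ℝ) < N := by exact_mod_cast hN
  have hpi := Real.pi_pos
  have hvi : ∀ x, u x - interp N u x = v x - interp N v x := by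
    intro x
    rw [hv, interp_sub, interp_trigPoly hN]
    ring
  have hIc : Continuous (interp N v) := continuous_trigPoly _ _
  have hvc : Continuous v := hu.sub (continuous_trigPoly _ _)
  have h1 : ∫ x in (0 : ℝ)..(2 * Real.pi), ‖interp N v x‖ ^ 2 ≤ 2 * Real.pi * ε ^ 2 := by
    unfold interp
    rw [integral_norm_sq_trigPoly]
    have hb := sum_sq_dftCoeff_le hN v
    have hs : ∑ j ∈ Finset.range (2 * N), ‖v (node N j)‖ ^ 2 ≤ 2 * N * ε ^ 2 := by
      calc _ ≤ ∑ _j ∈ Finset.range (2 * N), ε ^ 2 :=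
            Finset.sum_le_sum fun j _ => pow_le_pow_left₀ (norm_nonneg _) (h _) 2
        _ = _ := by simp
    have := le_of_mul_le_mul_left (hb.trans hs) (by positivity)
    gcongr
  have h2 : ∫ x in (0 : ℝ)..(2 * Real.pi), ‖v x - interp N v x‖ ^ 2
      ≤ ∫ x in (0 : ℝ)..(2 * Real.pi), (2 * ε ^ 2 + 2 * ‖interp N v x‖ ^ 2) := by
    refine intervalIntegral.integral_mono_on (by positivity)
      (Continuous.intervalIntegrable (by fun_prop) _ _)
      (Continuous.intervalIntegrable (by fun_prop) _ _) fun x _ => ?_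
    have ha := norm_sub_le (v x) (interp N v x)
    have hb := h x
    change ‖v x‖ ≤ ε at hb
    have hc := norm_nonneg (v x - interp N v x)
    nlinarith [sq_nonneg (ε - ‖interp N v x‖)]
  rw [intervalIntegral.integral_add (Continuous.intervalIntegrable (by fun_prop) _ _)
    (Continuous.intervalIntegrable (by fun_prop) _ _),
    intervalIntegral.integral_const, intervalIntegral.integral_const_mul] at h2
  simp only [smul_eq_mul, sub_zero] at h2
  unfold l2norm
  simp_rw [hvi]
  rw [← Real.sqrt_sq hε, ← Real.sqrt_mul (by positivity)]
  apply Real.sqrt_le_sqrt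
  linarith

/-! ### The Fejér–Korovkin kernel -/

/-- The coefficients whose squared trigonometric sum is the Fejér–Korovkin kernel. -/
def korovkinCoeff (N k : ℕ) : ℝ := Real.sin ((k + 1) * (Real.pi / (N + 1)))

/-- The unnormalised Fejér–Korovkin kernel. -/
def korovkinKernel (N : ℕ) (t : ℝ) : ℝ :=
  ∑ k ∈ Finset.range N, ∑ l ∈ Finset.range N,
    korovkinCoeff N k * korovkinCoeff N l * Real.cos (((k - l : ℤ) : ℝ) * t)

/-- The mean of the Fejér–Korovkin kernel. -/
def korovkinMass (N : ℕ) : ℝ := ∑ k ∈ Finset.range N, korovkinCoeff N k ^ 2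

theorem korovkinKernel_nonneg (N : ℕ) (t : ℝ) : 0 ≤ korovkinKernel N t := by
  have : korovkinKernel N t = (∑ k ∈ Finset.range N, korovkinCoeff N k * Real.cos (k * t)) ^ 2
      + (∑ k ∈ Finset.range N, korovkinCoeff N k * Real.sin (k * t)) ^ 2 := by
    rw [sq, sq, Finset.sum_mul_sum, Finset.sum_mul_sum, ← Finset.sum_add_distrib]
    refine Finset.sum_congr rfl fun k _ => ?_
    rw [← Finset.sum_add_distrib]
    refine Finset.sum_congr rfl fun l _ => ?_
    push_cast
    rw [sub_mul, Real.cos_sub]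
    ring
  rw [this]
  positivity

theorem korovkinKernel_neg (N : ℕ) (t : ℝ) : korovkinKernel N (-t) = korovkinKernel N t := by
  simp only [korovkinKernel, mul_neg, Real.cos_neg]

theorem continuous_korovkinKernel (N : ℕ) : Continuous (korovkinKernel N) := by
  unfold korovkinKernel
  fun_prop

theorem korovkinKernel_periodic (N : ℕ) : Function.Periodic (korovkinKernel N) (2 * Real.pi) := by
  intro t
  unfold korovkinKernel
  refine Finset.sum_congr rfl fun k _ => Finset.sum_congr rfl fun l _ => ?_
  rw [mul_add, Real.cos_add_int_mul_two_pi]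

theorem korovkinMass_pos {N : ℕ} (hN : 1 ≤ N) : 0 < korovkinMass N := by
  have h0 : 0 < korovkinCoeff N 0 := by
    have hpi := Real.pi_pos
    have hN' : (0 : ℝ) < N := by exact_mod_cast hN
    refine Real.sin_pos_of_pos_of_lt_pi (by positivity) ?_
    rw [Nat.cast_zero, zero_add, one_mul]
    exact div_lt_self hpi (by linarith)
  exact Finset.sum_pos' (fun k _ => sq_nonneg _) ⟨0, Finset.mem_range.mpr hN, by positivity⟩

theorem integral_cos_int_mul (m : ℤ) :
    ∫ t in (-Real.pi)..Real.pi, Real.cos (m * t) = if m = 0 then 2 * Real.pi else 0 := by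
  split_ifs with h
  · simp [h]
    ring
  · have hm : (m : ℝ) ≠ 0 := by exact_mod_cast h
    rw [intervalIntegral.integral_comp_mul_left (fun t => Real.cos t) hm]
    simp [Real.sin_int_mul_pi]

theorem integral_korovkinKernel (N : ℕ) :
    ∫ t in (-Real.pi)..Real.pi, korovkinKernel N t = 2 * Real.pi * korovkinMass N := by
  unfold korovkinKernel korovkinMass
  rw [intervalIntegral.integral_finsetSum
    fun k _ => Continuous.intervalIntegrable (by fun_prop) _ _, Finset.mul_sum]
  refine Finset.sum_congr rfl fun k hk => ?_
  rw [intervalIntegral.integral_finsetSum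
    fun k _ => Continuous.intervalIntegrable (by fun_prop) _ _]
  simp_rw [intervalIntegral.integral_const_mul, integral_cos_int_mul, sub_eq_zero, Nat.cast_inj,
    mul_ite, mul_zero]
  rw [Finset.sum_ite_eq, if_pos hk]
  ring

theorem sum_korovkinCoeff_neighbours {N k : ℕ} (hk : k ∈ Finset.range N) :
    ∑ l ∈ Finset.range N, korovkinCoeff N l *
      ((if (k : ℤ) - l + 1 = 0 then 1 else 0) + if (k : ℤ) - l - 1 = 0 then 1 else 0)
      = 2 * Real.cos (Real.pi / (N + 1)) * korovkinCoeff N k := by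
  have hN' : (N : ℝ) + 1 ≠ 0 := by positivity
  rw [Finset.mem_range] at hk
  have hup : ∑ l ∈ Finset.range N, korovkinCoeff N l *
      (if (k : ℤ) - l + 1 = 0 then 1 else 0) = Real.sin ((k + 2) * (Real.pi / (N + 1))) := by
    have : ∀ l ∈ Finset.range N, korovkinCoeff N l * (if (k : ℤ) - l + 1 = 0 then (1 : ℝ) else 0)
        = if k + 1 = l then korovkinCoeff N l else 0 := by
      intro l _
      rw [mul_ite, mul_one, mul_zero]
      congr 1
      apply propext
      omega
    rw [Finset.sum_congr rfl this, Finset.sum_ite_eq]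
    split_ifs with h
    · rw [korovkinCoeff]
      push_cast
      ring_nf
    · rw [Finset.mem_range] at h
      have : N = k + 1 := by omega
      subst this
      push_cast at hN' ⊢
      rw [show ((k : ℝ) + 2) * (Real.pi / (k + 1 + 1)) = Real.pi by field_simp; ring, Real.sin_pi]
  have hdown : ∑ l ∈ Finset.range N, korovkinCoeff N l *
      (if (k : ℤ) - l - 1 = 0 then 1 else 0) = Real.sin (k * (Real.pi / (N + 1))) := by
    rcases k with _ | k
    · rw [Finset.sum_eq_zero]
      · simp
      · intro l _
        rw [if_neg (by omega), mul_zero]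
    · have : ∀ l ∈ Finset.range N, korovkinCoeff N l *
          (if ((k + 1 : ℕ) : ℤ) - l - 1 = 0 then (1 : ℝ) else 0)
          = if k = l then korovkinCoeff N l else 0 := by
        intro l _
        rw [mul_ite, mul_one, mul_zero]
        congr 1
        apply propext
        omega
      rw [Finset.sum_congr rfl this, Finset.sum_ite_eq,
        if_pos (Finset.mem_range.mpr (by omega)), korovkinCoeff]
      push_cast
      rfl
  simp_rw [mul_add]
  rw [Finset.sum_add_distrib, hup, hdown, korovkinCoeff]
  set θ := Real.pi / ((N : ℝ) + 1)
  rw [show ((k : ℝ) + 2) * θ = (k + 1) * θ + θ by ring,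
    show (k : ℝ) * θ = (k + 1) * θ - θ by ring, Real.sin_add, Real.sin_sub]
  ring

theorem integral_korovkinKernel_mul_cos (N : ℕ) :
    ∫ t in (-Real.pi)..Real.pi, korovkinKernel N t * Real.cos t
      = 2 * Real.pi * korovkinMass N * Real.cos (Real.pi / (N + 1)) := by
  unfold korovkinKernel korovkinMass
  simp_rw [Finset.sum_mul]
  rw [intervalIntegral.integral_finsetSum
    fun k _ => Continuous.intervalIntegrable (by fun_prop) _ _, Finset.mul_sum, Finset.sum_mul]
  refine Finset.sum_congr rfl fun k hk => ?_
  rw [intervalIntegral.integral_finsetSum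
    fun k _ => Continuous.intervalIntegrable (by fun_prop) _ _]
  have h : ∀ l : ℕ, ∫ t in (-Real.pi)..Real.pi,
      korovkinCoeff N k * korovkinCoeff N l * Real.cos (((k - l : ℤ) : ℝ) * t) * Real.cos t
      = Real.pi * korovkinCoeff N k * (korovkinCoeff N l *
        ((if (k : ℤ) - l + 1 = 0 then 1 else 0) + if (k : ℤ) - l - 1 = 0 then 1 else 0)) := by
    intro l
    have e : ∀ t : ℝ,
        korovkinCoeff N k * korovkinCoeff N l * Real.cos (((k - l : ℤ) : ℝ) * t) * Real.cos t
        = korovkinCoeff N k * korovkinCoeff N l / 2 * (Real.cos (((k - l + 1 : ℤ) : ℝ) * t)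
          + Real.cos (((k - l - 1 : ℤ) : ℝ) * t)) := by
      intro t
      rw [Int.cast_add _ 1, Int.cast_sub _ 1, Int.cast_one, add_mul, sub_mul _ 1, one_mul,
        Real.cos_add, Real.cos_sub]
      ring
    simp_rw [e]
    rw [intervalIntegral.integral_const_mul, intervalIntegral.integral_add
      (Continuous.intervalIntegrable (by fun_prop) _ _)
      (Continuous.intervalIntegrable (by fun_prop) _ _), integral_cos_int_mul,
      integral_cos_int_mul]
    split_ifs <;> ring
  simp_rw [h]
  rw [← Finset.mul_sum, sum_korovkinCoeff_neighbours hk]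
  ring

theorem sq_le_mul_one_sub_cos {t : ℝ} (ht : |t| ≤ Real.pi) :
    t ^ 2 ≤ Real.pi ^ 2 / 2 * (1 - Real.cos t) := by
  have h := Real.cos_le_one_sub_mul_cos_sq ht
  have hpi := Real.pi_pos
  have : 2 / Real.pi ^ 2 * t ^ 2 ≤ 1 - Real.cos t := by linarith
  calc t ^ 2 = Real.pi ^ 2 / 2 * (2 / Real.pi ^ 2 * t ^ 2) := by field_simp
    _ ≤ _ := by gcongr

theorem integral_korovkinKernel_mul_sq_le {N : ℕ} (hN : 1 ≤ N) :
    ∫ t in (-Real.pi)..Real.pi, korovkinKernel N t * t ^ 2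
      ≤ 2 * Real.pi * korovkinMass N * (Real.pi ^ 4 / 4 * ((N : ℝ) ^ 2)⁻¹) := by
  have hpi := Real.pi_pos
  have hK := continuous_korovkinKernel N
  have hm := korovkinMass_pos hN
  have hN' : (0 : ℝ) < N := by exact_mod_cast hN
  have h1 : ∫ t in (-Real.pi)..Real.pi, korovkinKernel N t * t ^ 2
      ≤ ∫ t in (-Real.pi)..Real.pi,
        Real.pi ^ 2 / 2 * (korovkinKernel N t - korovkinKernel N t * Real.cos t) := by
    refine intervalIntegral.integral_mono_on (by linarith)
      (Continuous.intervalIntegrable (by fun_prop) _ _)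
      (Continuous.intervalIntegrable (by fun_prop) _ _) fun t ht => ?_
    have := mul_le_mul_of_nonneg_left (sq_le_mul_one_sub_cos (abs_le.mpr ht))
      (korovkinKernel_nonneg N t)
    linarith
  rw [intervalIntegral.integral_const_mul, intervalIntegral.integral_sub
    (Continuous.intervalIntegrable (by fun_prop) _ _)
    (Continuous.intervalIntegrable (by fun_prop) _ _), integral_korovkinKernel,
    integral_korovkinKernel_mul_cos] at h1
  have h2 : 1 - Real.cos (Real.pi / (N + 1)) ≤ Real.pi ^ 2 / 2 * ((N : ℝ) ^ 2)⁻¹ := by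
    have h3 := Real.one_sub_sq_div_two_le_cos (x := Real.pi / ((N : ℝ) + 1))
    have h4 : (Real.pi / ((N : ℝ) + 1)) ^ 2 ≤ (Real.pi / N) ^ 2 := by
      gcongr
      linarith
    have h5 : (Real.pi / N) ^ 2 = Real.pi ^ 2 * ((N : ℝ) ^ 2)⁻¹ := by rw [div_pow, div_eq_mul_inv]
    linarith
  have h6 := mul_le_mul_of_nonneg_left h2
    (by positivity : 0 ≤ Real.pi ^ 2 / 2 * (2 * Real.pi * korovkinMass N))
  linarith

theorem exists_trigPoly_eq_sum {ι : Type*} (N : ℕ) (s : Finset ι) (m : ι → ℤ) (d : ι → ℂ)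
    (hm : ∀ i ∈ s, m i ∈ Finset.Icc (-(N : ℤ)) ((N : ℤ) - 1)) :
    ∃ c, ∀ x, trigPoly N c x = ∑ i ∈ s, d i * Complex.exp (Complex.I * m i * x) := by
  refine ⟨fun k => ∑ i ∈ s, if k = m i then d i else 0, fun x => ?_⟩
  unfold trigPoly
  simp_rw [Finset.sum_mul, ite_mul, zero_mul]
  rw [Finset.sum_comm]
  refine Finset.sum_congr rfl fun i hi => ?_
  rw [Finset.sum_ite_eq', if_pos (hm i hi)]

theorem exists_trigPoly_eq_convolution (N : ℕ) {u : ℝ → ℝ} (hu : Continuous u) (C : ℝ) :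
    ∃ c, ∀ x, trigPoly N c x
      = ((C * ∫ y in (-Real.pi)..Real.pi, u y * korovkinKernel N (x - y) : ℝ) : ℂ) := by
  obtain ⟨c, hc⟩ := exists_trigPoly_eq_sum N (Finset.range N ×ˢ Finset.range N)
    (fun i => (i.1 : ℤ) - i.2)
    (fun i => C * (korovkinCoeff N i.1 * korovkinCoeff N i.2 *
      ∫ y in (-Real.pi)..Real.pi, u y * Complex.exp (-(Complex.I * ((i.1 : ℂ) - i.2) * y))))
    (fun i hi => by
      rw [Finset.mem_product, Finset.mem_range, Finset.mem_range] at hi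
      rw [Finset.mem_Icc]
      omega)
  refine ⟨c, fun x => ?_⟩
  have hker : ∀ t : ℝ, (korovkinKernel N t : ℂ) = ∑ i ∈ Finset.range N ×ˢ Finset.range N,
      (korovkinCoeff N i.1 * korovkinCoeff N i.2 : ℂ) *
        Complex.exp (Complex.I * ((i.1 : ℂ) - i.2) * t) := by
    intro t
    rw [Finset.sum_product]
    have hswap : ∑ k ∈ Finset.range N, ∑ l ∈ Finset.range N,
        (korovkinCoeff N k * korovkinCoeff N l : ℂ) *
          Complex.exp (Complex.I * ((k : ℂ) - l) * t)
        = ∑ k ∈ Finset.range N, ∑ l ∈ Finset.range N,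
        (korovkinCoeff N k * korovkinCoeff N l : ℂ) *
          Complex.exp (-(Complex.I * ((k : ℂ) - l) * t)) := by
      rw [Finset.sum_comm]
      refine Finset.sum_congr rfl fun k _ => Finset.sum_congr rfl fun l _ => ?_
      rw [mul_comm (korovkinCoeff N l : ℂ)]
      congr 2
      ring
    have hdouble : (2 : ℂ) * korovkinKernel N t = ∑ k ∈ Finset.range N, ∑ l ∈ Finset.range N,
        (korovkinCoeff N k * korovkinCoeff N l : ℂ) *
          Complex.exp (Complex.I * ((k : ℂ) - l) * t)
        + ∑ k ∈ Finset.range N, ∑ l ∈ Finset.range N,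
        (korovkinCoeff N k * korovkinCoeff N l : ℂ) *
          Complex.exp (-(Complex.I * ((k : ℂ) - l) * t)) := by
      unfold korovkinKernel
      push_cast
      simp_rw [← Finset.sum_add_distrib, Finset.mul_sum]
      refine Finset.sum_congr rfl fun k _ => Finset.sum_congr rfl fun l _ => ?_
      rw [mul_left_comm, Complex.two_cos, ← mul_add]
      congr 3 <;> ring
    rw [← hswap] at hdouble
    linear_combination hdouble / 2
  rw [hc, Complex.ofReal_mul, ← intervalIntegral.integral_ofReal]
  simp_rw [Complex.ofReal_mul, hker, Finset.mul_sum]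
  rw [intervalIntegral.integral_finsetSum
    fun k _ => Continuous.intervalIntegrable (by fun_prop) _ _, Finset.mul_sum]
  refine Finset.sum_congr rfl fun i _ => ?_
  rw [mul_assoc, mul_assoc, ← intervalIntegral.integral_mul_const,
    ← intervalIntegral.integral_const_mul]
  congr 1
  refine intervalIntegral.integral_congr fun y _ => ?_
  rw [mul_assoc (u y : ℂ), ← Complex.exp_add, mul_left_comm]
  push_cast
  congr 3
  ring_nf

theorem integral_mul_korovkinKernel_sub (N : ℕ) {u : ℝ → ℝ}
    (hper : Function.Periodic u (2 * Real.pi)) (x : ℝ) :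
    ∫ y in (-Real.pi)..Real.pi, u y * korovkinKernel N (x - y)
      = ∫ t in (-Real.pi)..Real.pi, korovkinKernel N t * u (x - t) := by
  have h := intervalIntegral.integral_comp_sub_left
    (fun t => korovkinKernel N t * u (x - t)) x (a := -Real.pi) (b := Real.pi)
  have hp : Function.Periodic (fun t => korovkinKernel N t * u (x - t)) (2 * Real.pi) := by
    intro t
    simp only
    rw [korovkinKernel_periodic N t, ← sub_sub, hper.sub_eq]
  have h2 := hp.intervalIntegral_add_eq (x - Real.pi) (-Real.pi)
  rw [show x - Real.pi + 2 * Real.pi = x - -Real.pi by ring,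
    show -Real.pi + 2 * Real.pi = Real.pi by ring] at h2
  rw [← h2, ← h]
  simp only [sub_sub_cancel, mul_comm]

/-- A Jackson-type estimate. -/
theorem exists_norm_sub_trigPoly_le {N : ℕ} (hN : 1 ≤ N) {u : ℝ → ℝ} {M : ℝ} (hu : Continuous u)
    (hper : Function.Periodic u (2 * Real.pi))
    (h : ∀ x t, |u (x + t) + u (x - t) - 2 * u x| ≤ M * t ^ 2) :
    ∃ c, ∀ x, ‖(u x : ℂ) - trigPoly N c x‖ ≤ M * (Real.pi ^ 4 / 8) * ((N : ℝ) ^ 2)⁻¹ := by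
  have hpi := Real.pi_pos
  have hK := continuous_korovkinKernel N
  have hm := korovkinMass_pos hN
  have hM : 0 ≤ M := by simpa using (abs_nonneg _).trans (h 0 1)
  set A := 2 * Real.pi * korovkinMass N with hA
  have hA0 : 0 < A := by positivity
  obtain ⟨c, hc⟩ := exists_trigPoly_eq_convolution N hu A⁻¹
  refine ⟨c, fun x => ?_⟩
  rw [hc, ← Complex.ofReal_sub, Complex.norm_real, Real.norm_eq_abs,
    integral_mul_korovkinKernel_sub N hper]
  set J := ∫ t in (-Real.pi)..Real.pi, korovkinKernel N t * u (x - t) with hJ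
  have hJ' : ∫ t in (-Real.pi)..Real.pi, korovkinKernel N t * u (x + t) = J := by
    have := intervalIntegral.integral_comp_neg (a := -Real.pi) (b := Real.pi)
      (fun t => korovkinKernel N t * u (x - t))
    simpa [korovkinKernel_neg, hJ] using this
  have hdiff : ∫ t in (-Real.pi)..Real.pi,
      korovkinKernel N t * (u (x + t) + u (x - t) - 2 * u x) = 2 * J - 2 * (A * u x) := by
    have e : ∀ t, korovkinKernel N t * (u (x + t) + u (x - t) - 2 * u x)
        = korovkinKernel N t * u (x + t) + korovkinKernel N t * u (x - t)
          - korovkinKernel N t * (2 * u x) := fun t => by ring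
    simp_rw [e]
    rw [intervalIntegral.integral_sub (Continuous.intervalIntegrable (by fun_prop) _ _)
      (Continuous.intervalIntegrable (by fun_prop) _ _), intervalIntegral.integral_add
      (Continuous.intervalIntegrable (by fun_prop) _ _)
      (Continuous.intervalIntegrable (by fun_prop) _ _), hJ', intervalIntegral.integral_mul_const,
      integral_korovkinKernel]
    ring
  have hbound : |2 * J - 2 * (A * u x)| ≤ M * (A * (Real.pi ^ 4 / 4 * ((N : ℝ) ^ 2)⁻¹)) := by
    rw [← hdiff, ← Real.norm_eq_abs]
    calc _ ≤ ∫ t in (-Real.pi)..Real.pi, M * (korovkinKernel N t * t ^ 2) := by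
          refine intervalIntegral.norm_integral_le_of_norm_le (by linarith)
            (Filter.Eventually.of_forall fun t _ => ?_)
            (Continuous.intervalIntegrable (by fun_prop) _ _)
          rw [Real.norm_eq_abs, abs_mul, abs_of_nonneg (korovkinKernel_nonneg N t)]
          have := mul_le_mul_of_nonneg_left (h x t) (korovkinKernel_nonneg N t)
          linarith
      _ ≤ _ := by
          rw [intervalIntegral.integral_const_mul]
          exact mul_le_mul_of_nonneg_left (integral_korovkinKernel_mul_sq_le hN) hM
  have e : u x - A⁻¹ * J = -(2 * A)⁻¹ * (2 * J - 2 * (A * u x)) := by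
    field_simp
    ring
  rw [e, abs_mul, abs_neg, abs_of_pos (by positivity)]
  calc _ ≤ (2 * A)⁻¹ * (M * (A * (Real.pi ^ 4 / 4 * ((N : ℝ) ^ 2)⁻¹))) := by gcongr
    _ = _ := by
      field_simp
      ring

/-! ### The odd-even extension is `C^{1,1}` -/

theorem exists_arccos_cos_eq (x : ℝ) :
    ∃ n : ℤ, Real.arccos (Real.cos x) = |x - n * (2 * Real.pi)| := by
  have hp : 0 < 2 * Real.pi := Real.two_pi_pos
  have h1 : |x - round (x / (2 * Real.pi)) * (2 * Real.pi)| ≤ Real.pi := by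
    have h := abs_sub_round (x / (2 * Real.pi))
    have h2 : x - round (x / (2 * Real.pi)) * (2 * Real.pi)
        = (x / (2 * Real.pi) - round (x / (2 * Real.pi))) * (2 * Real.pi) := by
      field_simp
    rw [h2, abs_mul, abs_of_pos hp]
    nlinarith
  refine ⟨round (x / (2 * Real.pi)), ?_⟩
  rw [← Real.arccos_cos (abs_nonneg _) h1, Real.cos_abs, Real.cos_sub_int_mul_two_pi]

theorem arccos_cos_le_abs_sub (x : ℝ) (n : ℤ) :
    Real.arccos (Real.cos x) ≤ |x - n * (2 * Real.pi)| := by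
  rcases le_total |x - n * (2 * Real.pi)| Real.pi with h | h
  · rw [← Real.cos_sub_int_mul_two_pi x n, ← Real.cos_abs (x - n * (2 * Real.pi)),
      Real.arccos_cos (abs_nonneg _) h]
  · exact (Real.arccos_le_pi _).trans h

theorem arccos_cos_sub_le (x y : ℝ) :
    |Real.arccos (Real.cos x) - Real.arccos (Real.cos y)| ≤ |x - y| := by
  have key : ∀ x y : ℝ,
      Real.arccos (Real.cos x) - Real.arccos (Real.cos y) ≤ |x - y| := by
    intro x y
    obtain ⟨n, hn⟩ := exists_arccos_cos_eq y
    have h1 := arccos_cos_le_abs_sub x n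
    have h2 := abs_sub_le x y (n * (2 * Real.pi))
    linarith
  rw [abs_le]
  have := key y x
  rw [abs_sub_comm] at this
  exact ⟨by linarith, key x y⟩

theorem arcsin_sin_sub_le (x y : ℝ) :
    |Real.arcsin (Real.sin x) - Real.arcsin (Real.sin y)| ≤ |x - y| := by
  have h := arccos_cos_sub_le (Real.pi / 2 - x) (Real.pi / 2 - y)
  rw [Real.cos_pi_div_two_sub, Real.cos_pi_div_two_sub, Real.arccos_eq_pi_div_two_sub_arcsin,
    Real.arccos_eq_pi_div_two_sub_arcsin] at h
  rwa [sub_sub_sub_cancel_left, sub_sub_sub_cancel_left, abs_sub_comm, abs_sub_comm y] at h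

theorem oddEvenExt_eq_oeCore (f : ℝ → ℝ) (x : ℝ) :
    oddEvenExt f x = oeCore f (Real.arccos (Real.cos x)) := by
  have hp : 0 < 2 * Real.pi := Real.two_pi_pos
  unfold oddEvenExt
  set y := x - 2 * Real.pi * (⌊x / (2 * Real.pi)⌋ : ℤ) with hy
  have hcos : Real.cos x = Real.cos y := by
    rw [hy, mul_comm (2 * Real.pi), Real.cos_sub_int_mul_two_pi]
  have h0 : 0 ≤ y := by
    have := Int.floor_le (x / (2 * Real.pi))
    rw [le_div_iff₀ hp] at this
    linarith
  have h2 : y < 2 * Real.pi := by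
    have := Int.lt_floor_add_one (x / (2 * Real.pi))
    rw [div_lt_iff₀ hp] at this
    linarith
  simp only
  split_ifs with h
  · rw [hcos, Real.arccos_cos h0 h]
  · rw [hcos, ← Real.cos_two_pi_sub, Real.arccos_cos (by linarith) (by linarith)]

/-- The odd extension of a function from `[0, ∞)` to `ℝ`. -/
def oddExt (g : ℝ → ℝ) (y : ℝ) : ℝ := if 0 ≤ y then g y else -g (-y)

theorem oddExt_neg {g : ℝ → ℝ} (hg0 : g 0 = 0) (y : ℝ) : oddExt g (-y) = -oddExt g y := by
  unfold oddExt
  rcases lt_trichotomy y 0 with h | h | h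
  · rw [if_pos (by linarith), if_neg (by linarith), neg_neg]
  · simp [h, hg0]
  · rw [if_neg (by linarith), if_pos h.le, neg_neg]

theorem abs_oddExt_sub_le {g : ℝ → ℝ} {M r : ℝ} (hg0 : g 0 = 0)
    (hg : ∀ x ∈ Set.Icc 0 r, ∀ y ∈ Set.Icc 0 r, |g x - g y| ≤ M * |x - y|)
    {x y : ℝ} (hx : |x| ≤ r) (hy : |y| ≤ r) :
    |oddExt g x - oddExt g y| ≤ M * |x - y| := by
  rw [abs_le] at hx hy
  have hr : 0 ≤ r := by linarith
  have mixed : ∀ s ∈ Set.Icc 0 r, ∀ t ∈ Set.Icc 0 r, |g s + g t| ≤ M * (s + t) := by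
    intro s hs t ht
    have h1 := hg s hs 0 ⟨le_rfl, hr⟩
    have h2 := hg t ht 0 ⟨le_rfl, hr⟩
    rw [hg0, sub_zero, sub_zero, abs_of_nonneg hs.1] at h1
    rw [hg0, sub_zero, sub_zero, abs_of_nonneg ht.1] at h2
    have := abs_add_le (g s) (g t)
    linarith
  unfold oddExt
  split_ifs with h1 h2 h2
  · exact hg x ⟨h1, hx.2⟩ y ⟨h2, hy.2⟩
  · have := mixed x ⟨h1, hx.2⟩ (-y) ⟨by linarith, by linarith⟩
    rw [abs_of_nonneg (by linarith : 0 ≤ x - y)]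
    simpa [sub_eq_add_neg] using this
  · have := mixed (-x) ⟨by linarith, by linarith⟩ y ⟨h2, hy.2⟩
    rw [abs_sub_comm x, abs_of_nonneg (by linarith : 0 ≤ y - x), abs_sub_comm]
    simpa [sub_eq_add_neg, add_comm] using this
  · have := hg (-x) ⟨by linarith, by linarith⟩ (-y) ⟨by linarith, by linarith⟩
    rw [neg_sub_neg, abs_sub_comm, abs_sub_comm x]
    rwa [neg_sub_neg] at this

theorem eq_of_hasDerivAt_zero {F : ℝ → ℝ} (hF : ∀ x, HasDerivAt F 0 x) (x y : ℝ) : F x = F y :=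
  is_const_of_deriv_eq_zero (fun x => (hF x).differentiableAt) (fun x => (hF x).deriv) x y

/-- A primitive of a function that is odd about `0` and even about `π / 2` and agrees with `f` on
`[0, π / 2]` is the odd-even extension of `f`. -/
theorem oddEvenExt_eq_of_hasDerivAt {f v G : ℝ → ℝ} (hv : ∀ x, HasDerivAt v (G x) x)
    (hodd : ∀ x, G (-x) = -G x) (heven : ∀ x, G (Real.pi - x) = G x)
    (hvf : ∀ x ∈ Set.Icc 0 (Real.pi / 2), v x = f x) : oddEvenExt f = v := by
  have hpi := Real.pi_pos
  have hneg : ∀ x, v (-x) = v x := by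
    intro x
    have := eq_of_hasDerivAt_zero (F := fun x => v (-x) - v x) (fun x => by
      have h := ((hv (-x)).scomp x (hasDerivAt_neg x)).sub (hv x)
      rw [hodd] at h
      exact h.congr_deriv (by simp)) x 0
    simp only [neg_zero, sub_self] at this
    linarith
  have hrefl : ∀ x, v x = 2 * v (Real.pi / 2) - v (Real.pi - x) := by
    intro x
    have := eq_of_hasDerivAt_zero (F := fun x => v (Real.pi - x) + v x) (fun x => by
      have h := ((hv (Real.pi - x)).scomp x ((hasDerivAt_id x).const_sub Real.pi)).add (hv x)
      rw [heven] at h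
      exact h.congr_deriv (by simp)) x (Real.pi / 2)
    simp only [sub_half] at this
    linarith
  have hper : Function.Periodic v (2 * Real.pi) := by
    intro x
    have h1 := hrefl (x + 2 * Real.pi)
    have h2 := hrefl (-(x + Real.pi))
    rw [hneg] at h2
    have h3 := hrefl (-x)
    have e1 : Real.pi - (x + 2 * Real.pi) = -(x + Real.pi) := by ring
    have e2 : Real.pi - -x = x + Real.pi := by ring
    rw [e1, hneg] at h1
    rw [e2, hneg] at h3
    linarith
  funext x
  rw [oddEvenExt_eq_oeCore]
  have hA : v x = v (Real.arccos (Real.cos x)) := by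
    obtain ⟨n, hn⟩ := exists_arccos_cos_eq x
    rw [hn]
    have habs : v |x - n * (2 * Real.pi)| = v (x - n * (2 * Real.pi)) := by
      rcases abs_choice (x - n * (2 * Real.pi)) with h | h <;> rw [h]
      rw [hneg]
    rw [habs, hper.sub_int_mul_eq]
  rw [hA]
  have h0 := Real.arccos_nonneg (Real.cos x)
  have h1 := Real.arccos_le_pi (Real.cos x)
  unfold oeCore
  split_ifs with h
  · exact (hvf _ ⟨h0, h⟩).symm
  · rw [hrefl, hvf (Real.pi / 2) ⟨by linarith, le_rfl⟩,
      hvf (Real.pi - _) ⟨by linarith, by linarith⟩]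

theorem exists_hasDerivAt_oddEvenExt {f g : ℝ → ℝ} {M : ℝ} (hM : 0 ≤ M)
    (hf : ContinuousOn f (Set.Icc 0 (Real.pi / 2)))
    (hfg : ∀ x ∈ Set.Ioo 0 (Real.pi / 2), HasDerivAt f (g x) x) (hg0 : g 0 = 0)
    (hg : ∀ x ∈ Set.Icc 0 (Real.pi / 2), ∀ y ∈ Set.Icc 0 (Real.pi / 2),
      |g x - g y| ≤ M * |x - y|) :
    ∃ G : ℝ → ℝ, (∀ x, HasDerivAt (oddEvenExt f) (G x) x) ∧
      ∀ x y, |G x - G y| ≤ M * |x - y| := by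
  have hpi := Real.pi_pos
  set G : ℝ → ℝ := fun x => oddExt g (Real.arcsin (Real.sin x)) with hG
  have hLip : ∀ x y, |G x - G y| ≤ M * |x - y| := by
    intro x y
    have hb : ∀ x, |Real.arcsin (Real.sin x)| ≤ Real.pi / 2 := fun x =>
      abs_le.mpr ⟨Real.neg_pi_div_two_le_arcsin _, Real.arcsin_le_pi_div_two _⟩
    exact (abs_oddExt_sub_le hg0 hg (hb x) (hb y)).trans
      (mul_le_mul_of_nonneg_left (arcsin_sin_sub_le x y) hM)
  have hGc : Continuous G := by
    refine (LipschitzWith.of_dist_le_mul (K := ⟨M, hM⟩) fun x y => ?_).continuous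
    rw [Real.dist_eq, Real.dist_eq]
    exact hLip x y
  have hv : ∀ x, HasDerivAt (fun x => f 0 + ∫ t in (0 : ℝ)..x, G t) (G x) x := fun x =>
    (intervalIntegral.integral_hasDerivAt_right (hGc.intervalIntegrable _ _)
      hGc.aestronglyMeasurable.stronglyMeasurableAtFilter hGc.continuousAt).const_add _
  refine ⟨G, ?_, hLip⟩
  rw [oddEvenExt_eq_of_hasDerivAt hv]
  · exact hv
  · intro x
    simp only [hG, Real.sin_neg, Real.arcsin_neg, oddExt_neg hg0]
  · intro x
    simp only [hG, Real.sin_pi_sub]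
  · intro x hx
    have := intervalIntegral.integral_eq_sub_of_hasDerivAt_of_le hx.1 (f := f) (f' := G)
      (hf.mono (Set.Icc_subset_Icc_right hx.2)) (fun t ht => by
        have h := hfg t ⟨ht.1, ht.2.trans_le hx.2⟩
        have : G t = g t := by
          simp only [hG]
          rw [Real.arcsin_sin (by linarith [ht.1]) (by linarith [ht.2, hx.2]), oddExt,
            if_pos ht.1.le]
        rwa [this]) (hGc.intervalIntegrable _ _)
    rw [this]
    ring

theorem abs_second_difference_le {u G : ℝ → ℝ} {M : ℝ} (hu : ∀ x, HasDerivAt u (G x) x)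
    (hG : ∀ x y, |G x - G y| ≤ M * |x - y|) (x t : ℝ) :
    |u (x + t) + u (x - t) - 2 * u x| ≤ M * t ^ 2 := by
  have key : ∀ t, 0 ≤ t → |u (x + t) + u (x - t) - 2 * u x| ≤ M * t ^ 2 := by
    intro t ht
    have hd : ∀ s, HasDerivAt (fun s => u (x + s) + u (x - s) - 2 * u x)
        (G (x + s) - G (x - s)) s := by
      intro s
      have h := (((hu (x + s)).scomp s ((hasDerivAt_id s).const_add x)).add
        ((hu (x - s)).scomp s ((hasDerivAt_id s).const_sub x))).sub_const (2 * u x)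
      exact h.congr_deriv (by simp [sub_eq_add_neg])
    have hB : ∀ s, HasDerivAt (fun s => M * s ^ 2) (M * (2 * s)) s := by
      intro s
      simpa using (hasDerivAt_pow 2 s).const_mul M
    have := image_norm_le_of_norm_deriv_right_le_deriv_boundary (a := 0) (b := t)
      (fun s _ => (hd s).continuousAt.continuousWithinAt)
      (fun s _ => (hd s).hasDerivWithinAt) (B := fun s => M * s ^ 2)
      (by simp; ring) hB (fun s hs => by
        have := hG (x + s) (x - s)
        rw [Real.norm_eq_abs]
        rw [show x + s - (x - s) = 2 * s by ring,
          abs_of_nonneg (by linarith [hs.1] : 0 ≤ 2 * s)] at this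
        exact this)
    exact this ⟨ht, le_rfl⟩
  rcases le_total 0 t with ht | ht
  · exact key t ht
  · have := key (-t) (by linarith)
    rw [sub_neg_eq_add, ← sub_eq_add_neg, add_comm (u _)] at this
    simpa using this

/-- Second-order interpolation error for the odd-even extension. -/
theorem interp_error_oddEvenExt
    (f : ℝ → ℝ)
    (hf1 : ∀ x ∈ Set.Ioo (0:ℝ) (Real.pi / 2), DifferentiableAt ℝ f x)
    (hf2 : ∀ x ∈ Set.Ioo (0:ℝ) (Real.pi / 2), DifferentiableAt ℝ (deriv f) x)
    (hfc : ContinuousOn f (Set.Icc (0:ℝ) (Real.pi / 2)))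
    -- f' extends continuously to [0, π/2] with f'(0⁺) = 0:
    (g : ℝ → ℝ) (hg : ContinuousOn g (Set.Icc (0:ℝ) (Real.pi / 2)))
    (hgf : ∀ x ∈ Set.Ioo (0:ℝ) (Real.pi / 2), g x = deriv f x)
    (hg0 : g 0 = 0)
    -- the one-sided limits f''(0⁺) and f''((π/2)⁻) exist:
    (a b : ℝ)
    (hf''0 : Filter.Tendsto (deriv (deriv f)) (nhdsWithin 0 (Set.Ioo (0:ℝ) (Real.pi / 2)))
      (nhds a))
    (hf''pi2 : Filter.Tendsto (deriv (deriv f))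
      (nhdsWithin (Real.pi / 2) (Set.Ioo (0:ℝ) (Real.pi / 2))) (nhds b))
    -- f'' is bounded on (0, π/2):
    (Mb : ℝ) (hMb : ∀ x ∈ Set.Ioo (0:ℝ) (Real.pi / 2), |deriv (deriv f) x| ≤ Mb) :
    ∃ K₁ : ℝ, ∀ N : ℕ, 1 ≤ N →
      l2norm (fun x => (oddEvenExt f x : ℂ) - interp N (fun y => (oddEvenExt f y : ℂ)) x)
        ≤ K₁ * ((N : ℝ) ^ 2)⁻¹ := by
  have hpi := Real.pi_pos
  have hM : 0 ≤ Mb :=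
    (abs_nonneg _).trans (hMb (Real.pi / 4) ⟨by positivity, by linarith⟩)
  have hg' : ∀ x ∈ Set.Ioo (0 : ℝ) (Real.pi / 2), HasDerivAt g (deriv (deriv f) x) x := by
    intro x hx
    refine (hf2 x hx).hasDerivAt.congr_of_eventuallyEq ?_
    filter_upwards [isOpen_Ioo.mem_nhds hx] with y hy using hgf y hy
  have hlt : ∀ x ∈ Set.Icc (0 : ℝ) (Real.pi / 2), ∀ y ∈ Set.Icc (0 : ℝ) (Real.pi / 2), x < y →
      |g x - g y| ≤ Mb * |x - y| := by
    intro x hx y hy hxy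
    obtain ⟨c, hc, hcs⟩ := exists_hasDerivAt_eq_slope g (deriv (deriv f)) hxy
      (hg.mono (Set.Icc_subset_Icc hx.1 hy.2))
      fun t ht => hg' t ⟨hx.1.trans_lt ht.1, ht.2.trans_le hy.2⟩
    rw [eq_div_iff (by linarith)] at hcs
    rw [abs_sub_comm, ← hcs, abs_mul, abs_sub_comm x]
    exact mul_le_mul_of_nonneg_right
      (hMb c ⟨hx.1.trans_lt hc.1, hc.2.trans_le hy.2⟩) (abs_nonneg _)
  have hLip : ∀ x ∈ Set.Icc (0 : ℝ) (Real.pi / 2), ∀ y ∈ Set.Icc (0 : ℝ) (Real.pi / 2),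
      |g x - g y| ≤ Mb * |x - y| := by
    intro x hx y hy
    rcases lt_trichotomy x y with h | h | h
    · exact hlt x hx y hy h
    · simp [h]
    · rw [abs_sub_comm, abs_sub_comm x]
      exact hlt y hy x hx h
  obtain ⟨G, hG, hGL⟩ := exists_hasDerivAt_oddEvenExt hM hfc
    (fun x hx => by rw [hgf x hx]; exact (hf1 x hx).hasDerivAt) hg0 hLip
  have hu : Continuous (oddEvenExt f) :=
    continuous_iff_continuousAt.mpr fun x => (hG x).continuousAt
  have hper : Function.Periodic (oddEvenExt f) (2 * Real.pi) := fun x => by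
    rw [oddEvenExt_eq_oeCore, oddEvenExt_eq_oeCore, Real.cos_add_two_pi]
  refine ⟨Real.sqrt (8 * Real.pi) * (Mb * (Real.pi ^ 4 / 8)), fun N hN => ?_⟩
  obtain ⟨c, hc⟩ := exists_norm_sub_trigPoly_le hN hu hper (abs_second_difference_le hG hGL)
  rw [mul_assoc]
  exact l2norm_sub_interp_le hN (Complex.continuous_ofReal.comp hu) c (by positivity) hc

end
end

section
/- Gaussian-tail bound for the localization error: Let σ > 0, α ∈ ℝ, t < t₀, M > 0, and let φ : ℝ → ℝ be a measurable function with 0 ≤ φ(x̂) ≤ M for all x̂. For x̂* > 0 let φ_p^{x̂*} be the (8x̂*)-periodic odd-even extension of φ, defined by φ_p^{x̂*}(x̂) = φ(x̂) for x̂ ∈ [−x̂*, x̂*], φ_p^{x̂*}(x̂) = 2φ(x̂*) − φ_p^{x̂*}(2x̂* − x̂) for x̂ ∈ [x̂*, 3x̂*], φ_p^{x̂*}(x̂) = φ_p^{x̂*}(6x̂* − x̂) for x̂ ∈ [3x̂*, 7x̂*], and φ_p^{x̂*}(x̂) = φ_p^{x̂*}(x̂ − 8x̂*k) for the unique k ∈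 ℤ with x̂ − 8x̂*k ∈ [−x̂*, 7x̂*]. Define Θ(x̂', x̂) = (σ√(2π(t₀−t)))^{-1} exp(−[x̂' − (x̂ + (α − σ²/2)(t₀−t))]² / (2σ²(t₀−t))), R_p^{x̂*}(x̂) = ∫_ℝ φ_p^{x̂*}(x̂')Θ(x̂',x̂)dx̂' and R(x̂) = ∫_ℝ φ(x̂')Θ(x̂',x̂)dx̂'. Then for every x̂ ∈ ℝ, |R_p^{x̂*}(x̂) − R(x̂)| ≤ 3M(∫_{−∞}^{−x̂*} Θ(x̂',x̂)dx̂' + ∫_{x̂*}^{∞} Θ(x̂',x̂)dx̂'). -/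
open Real MeasureTheory

noncomputable section

/-- The odd-even extension of `φ` on one period `[−x̂*, 7x̂*]`:
`φ` on `[−x̂*, x̂*]`, `2φ(x̂*) − φ_p(2x̂* − ŷ)` on `(x̂*, 3x̂*]`, and
`φ_p(6x̂* − ŷ)` on `(3x̂*, 7x̂*]` (the recursion is unfolded). -/
def oeExtCore (xs : ℝ) (φ : ℝ → ℝ) (y : ℝ) : ℝ :=
  if y ≤ xs then φ y
  else if y ≤ 3 * xs then 2 * φ xs - φ (2 * xs - y)
  else if 6 * xs - y ≤ xs then φ (6 * xs - y)
  else 2 * φ xs - φ (y - 4 * xs)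

/-- The `(8x̂*)`-periodic odd-even extension `φ_p^{x̂*}` of `φ`. -/
def perExt (xs : ℝ) (φ : ℝ → ℝ) (x : ℝ) : ℝ :=
  oeExtCore xs φ (x + xs - 8 * xs * (⌊(x + xs) / (8 * xs)⌋ : ℤ) - xs)

/-- The Gaussian kernel `Θ(x̂', x̂)` of the backward heat-transport equation. -/
def gaussKer (σ α t t₀ : ℝ) (x' x : ℝ) : ℝ :=
  (σ * Real.sqrt (2 * Real.pi * (t₀ - t)))⁻¹ *
    Real.exp (-(x' - (x + (α - σ ^ 2 / 2) * (t₀ - t))) ^ 2 / (2 * σ ^ 2 * (t₀ - t)))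

/-- `R_p^{x̂*}(x̂) = ∫ φ_p^{x̂*}(x̂')Θ(x̂',x̂)dx̂'`. -/
def Rper (σ α t t₀ xs : ℝ) (φ : ℝ → ℝ) (x : ℝ) : ℝ :=
  ∫ x' : ℝ, perExt xs φ x' * gaussKer σ α t t₀ x' x

/-- `R(x̂) = ∫ φ(x̂')Θ(x̂',x̂)dx̂'`. -/
def Rfun (σ α t t₀ : ℝ) (φ : ℝ → ℝ) (x : ℝ) : ℝ :=
  ∫ x' : ℝ, φ x' * gaussKer σ α t t₀ x' x

theorem measurable_oeExtCore (xs : ℝ) {φ : ℝ → ℝ} (hmeas : Measurable φ) :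
    Measurable (oeExtCore xs φ) := by
  unfold oeExtCore
  refine Measurable.ite measurableSet_Iic hmeas
    (Measurable.ite measurableSet_Iic (by fun_prop)
      (Measurable.ite (measurableSet_le (by fun_prop) measurable_const) (by fun_prop)
        (by fun_prop)))

theorem measurable_perExt (xs : ℝ) {φ : ℝ → ℝ} (hmeas : Measurable φ) :
    Measurable (perExt xs φ) := by
  refine (measurable_oeExtCore xs hmeas).comp ?_
  have hfloor : Measurable fun x : ℝ => ((⌊(x + xs) / (8 * xs)⌋ : ℤ) : ℝ) :=
    (measurable_from_top (f := fun n : ℤ => (n : ℝ))).comp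
      (Int.measurable_floor.comp (by fun_prop))
  fun_prop

theorem oeExtCore_mem_Icc (xs : ℝ) {M : ℝ} {φ : ℝ → ℝ} (hφ : ∀ x, 0 ≤ φ x ∧ φ x ≤ M) (y : ℝ) :
    oeExtCore xs φ y ∈ Set.Icc (-M) (2 * M) := by
  have h₁ := hφ xs
  unfold oeExtCore
  rw [Set.mem_Icc]
  split_ifs
  · have := hφ y
    constructor <;> linarith
  · have := hφ (2 * xs - y)
    constructor <;> linarith
  · have := hφ (6 * xs - y)
    constructor <;> linarith
  · have := hφ (y - 4 * xs)
    constructor <;> linarith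

theorem perExt_mem_Icc (xs : ℝ) {M : ℝ} {φ : ℝ → ℝ} (hφ : ∀ x, 0 ≤ φ x ∧ φ x ≤ M) (x : ℝ) :
    perExt xs φ x ∈ Set.Icc (-M) (2 * M) :=
  oeExtCore_mem_Icc xs hφ _

theorem perExt_eq_self {xs : ℝ} (hxs : 0 < xs) (φ : ℝ → ℝ) {x : ℝ} (hx : x ∈ Set.Icc (-xs) xs) :
    perExt xs φ x = φ x := by
  obtain ⟨h₁, h₂⟩ := hx
  have hfloor : ⌊(x + xs) / (8 * xs)⌋ = 0 := by
    rw [Int.floor_eq_zero_iff, Set.mem_Ico, div_lt_one (by positivity)]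
    exact ⟨div_nonneg (by linarith) (by positivity), by linarith⟩
  simp [perExt, oeExtCore, hfloor, h₂]

theorem gaussKer_nonneg {σ : ℝ} (hσ : 0 < σ) (α t t₀ x' x : ℝ) : 0 ≤ gaussKer σ α t t₀ x' x := by
  unfold gaussKer
  positivity

theorem integrable_gaussKer {σ t t₀ : ℝ} (hσ : 0 < σ) (ht : t < t₀) (α x : ℝ) :
    Integrable fun x' => gaussKer σ α t t₀ x' x := by
  have hτ : 0 < t₀ - t := sub_pos.2 ht
  have hb : 0 < (2 * σ ^ 2 * (t₀ - t))⁻¹ := by positivity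
  refine (((integrable_exp_neg_mul_sq hb).comp_sub_right
    (x + (α - σ ^ 2 / 2) * (t₀ - t))).const_mul
      (σ * Real.sqrt (2 * Real.pi * (t₀ - t)))⁻¹).congr (Filter.Eventually.of_forall fun x' => ?_)
  simp only [gaussKer]
  congr 2
  ring

/-- Gaussian-tail bound for the localization error. -/
theorem localization_error_gaussian_tail_bound
    (σ α t t₀ M : ℝ) (hσ : 0 < σ) (ht : t < t₀) (hM : 0 < M)
    (xs : ℝ) (hxs : 0 < xs)
    (φ : ℝ → ℝ) (hmeas : Measurable φ) (hφ : ∀ x : ℝ, 0 ≤ φ x ∧ φ x ≤ M) :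
    ∀ x : ℝ,
      |Rper σ α t t₀ xs φ x - Rfun σ α t t₀ φ x|
        ≤ 3 * M * ((∫ x' in Set.Iic (-xs), gaussKer σ α t t₀ x' x)
            + ∫ x' in Set.Ici xs, gaussKer σ α t t₀ x' x) := by
  intro x
  have hΘ := integrable_gaussKer hσ ht α x
  have hΘ0 : ∀ x', 0 ≤ gaussKer σ α t t₀ x' x := fun x' => gaussKer_nonneg hσ α t t₀ x' x
  have hper : Integrable fun x' => perExt xs φ x' * gaussKer σ α t t₀ x' x := by
    refine hΘ.bdd_mul (c := 2 * M) (measurable_perExt xs hmeas).aestronglyMeasurable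
      (Filter.Eventually.of_forall fun x' => ?_)
    have := perExt_mem_Icc xs hφ x'
    exact abs_le.2 ⟨by linarith [this.1], this.2⟩
  have hfun : Integrable fun x' => φ x' * gaussKer σ α t t₀ x' x := by
    refine hΘ.bdd_mul (c := M) hmeas.aestronglyMeasurable
      (Filter.Eventually.of_forall fun x' => ?_)
    exact abs_le.2 ⟨by linarith [(hφ x').1], (hφ x').2⟩
  have hdisj : Disjoint (Set.Iic (-xs)) (Set.Ici xs) :=
    Set.disjoint_left.2 fun y h₁ h₂ => by
      rw [Set.mem_Iic] at h₁
      rw [Set.mem_Ici] at h₂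
      linarith
  rw [← setIntegral_union hdisj measurableSet_Ici hΘ.integrableOn hΘ.integrableOn,
    ← integral_indicator (measurableSet_Iic.union measurableSet_Ici), ← integral_const_mul,
    Rper, Rfun, ← integral_sub hper hfun, ← Real.norm_eq_abs]
  refine norm_integral_le_of_norm_le
    ((hΘ.indicator (measurableSet_Iic.union measurableSet_Ici)).const_mul _)
    (Filter.Eventually.of_forall fun x' => ?_)
  rw [← sub_mul, norm_mul, Real.norm_eq_abs, Real.norm_of_nonneg (hΘ0 x')]
  by_cases hx' : x' ∈ Set.Iic (-xs) ∪ Set.Ici xs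
  · rw [Set.indicator_of_mem hx']
    refine mul_le_mul_of_nonneg_right ?_ (hΘ0 x')
    have h₁ := perExt_mem_Icc xs hφ x'
    have h₂ := hφ x'
    exact abs_le.2 ⟨by linarith [h₁.1], by linarith [h₁.2]⟩
  · rw [Set.indicator_of_notMem hx']
    simp only [Set.mem_union, Set.mem_Iic, Set.mem_Ici, not_or, not_le] at hx'
    simp [perExt_eq_self hxs φ ⟨hx'.1.le, hx'.2.le⟩]

end
end
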